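/- Let (u, v, w) be a smooth solution of the vcmKdV equation and let Ψ₁ : ℝ² → ℂ⁴ be a nowhere-vanishing solution of the Lax pair at ζ = ζ₁, where ζ₁ ≠ ζ₁*. Then: (i) for every ζ ≠ ζ₁* and every solution Ψ of the Lax pair with potentials (u, v, w) at ζ, the function Ψ[1] = T[1](ζ)Ψ solves the Lax pair with potentials (u[1], v[1], w[1]) at ζ; (ii) the transformed potentials (u[1], v[1], w[1]) form a smooth solution of the vcmKdV equation. -/

import Mathlib

open Matrix Filter Topology

noncomputable section

/-- Partial derivative in the first (space) variable. -/
def dX (f : ℝ × ℝ → ℂ) : ℝ × ℝ → ℂ := fun p => deriv (fun x => f (x, p.2)) p.1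

/-- Partial derivative in the second (time) variable. -/
def dT (f : ℝ × ℝ → ℂ) : ℝ × ℝ → ℂ := fun p => deriv (fun t => f (p.1, t)) p.2

/-- Left-hand side of one component of the vcmKdV equation
`f_t + f_xxx + 3((q†q) f_x + (q†q_x) f)` for `q = (u,v,w)ᵀ`. -/
def vcmLHS (u v w f : ℝ × ℝ → ℂ) (p : ℝ × ℝ) : ℂ :=
  dT f p + dX (dX (dX f)) p
    + 3 * (((starRingEnd ℂ) (u p) * u p + (starRingEnd ℂ) (v p) * v p
            + (starRingEnd ℂ) (w p) * w p) * dX f p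
         + ((starRingEnd ℂ) (u p) * dX u p + (starRingEnd ℂ) (v p) * dX v p
            + (starRingEnd ℂ) (w p) * dX w p) * f p)

/-- The vector complex modified KdV equation
`q_t + q_xxx + 3(q_x q† q + q q† q_x) = 0` for `q = (u,v,w)ᵀ`. -/
def vcmKdVeq (u v w : ℝ × ℝ → ℂ) : Prop :=
  ∀ p : ℝ × ℝ, vcmLHS u v w u p = 0 ∧ vcmLHS u v w v p = 0 ∧ vcmLHS u v w w p = 0

/-- `J = diag(1, -1, -1, -1)`. -/
def Jmat : Matrix (Fin 4) (Fin 4) ℂ := Matrix.diagonal ![1, -1, -1, -1]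

/-- The potential matrix `Q` built from the entries `u, v, w`. -/
def Qmat (u v w : ℂ) : Matrix (Fin 4) (Fin 4) ℂ :=
  !![0, u, v, w;
     -((starRingEnd ℂ) u), 0, 0, 0;
     -((starRingEnd ℂ) v), 0, 0, 0;
     -((starRingEnd ℂ) w), 0, 0, 0]

/-- `U(ζ) = -iζJ + Q`. -/
def Umat (ζ u v w : ℂ) : Matrix (Fin 4) (Fin 4) ℂ :=
  (-Complex.I * ζ) • Jmat + Qmat u v w

/-- `V(ζ) = -4iζ³J + 4ζ²Q - 2iζ(Q² + Q_x)J + (-Q_xx + 2Q³ + Q_x Q - Q Q_x)`. -/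
def Vmat (ζ u v w ux vx wx uxx vxx wxx : ℂ) : Matrix (Fin 4) (Fin 4) ℂ :=
  (-4 * Complex.I * ζ ^ 3) • Jmat + (4 * ζ ^ 2) • Qmat u v w
    - (2 * Complex.I * ζ) • ((Qmat u v w ^ 2 + Qmat ux vx wx) * Jmat)
    + (-Qmat uxx vxx wxx + 2 * Qmat u v w ^ 3
        + Qmat ux vx wx * Qmat u v w - Qmat u v w * Qmat ux vx wx)

/-- `U(ζ)` as a matrix-valued field on `ℝ²`. -/
def Ufield (u v w : ℝ × ℝ → ℂ) (ζ : ℂ) (p : ℝ × ℝ) : Matrix (Fin 4) (Fin 4) ℂ :=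
  Umat ζ (u p) (v p) (w p)

/-- `V(ζ)` as a matrix-valued field on `ℝ²` (with `Q_x`, `Q_xx` the entrywise derivatives). -/
def Vfield (u v w : ℝ × ℝ → ℂ) (ζ : ℂ) (p : ℝ × ℝ) : Matrix (Fin 4) (Fin 4) ℂ :=
  Vmat ζ (u p) (v p) (w p) (dX u p) (dX v p) (dX w p)
    (dX (dX u) p) (dX (dX v) p) (dX (dX w) p)

/-- Entrywise `x`-derivative of a matrix-valued field. -/
def dXM (F : ℝ × ℝ → Matrix (Fin 4) (Fin 4) ℂ) (p : ℝ × ℝ) : Matrix (Fin 4) (Fin 4) ℂ :=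
  Matrix.of fun i j => deriv (fun x => F (x, p.2) i j) p.1

/-- Entrywise `t`-derivative of a matrix-valued field. -/
def dTM (F : ℝ × ℝ → Matrix (Fin 4) (Fin 4) ℂ) (p : ℝ × ℝ) : Matrix (Fin 4) (Fin 4) ℂ :=
  Matrix.of fun i j => deriv (fun t => F (p.1, t) i j) p.2

/-- `Ψ` solves the Lax pair `Ψ_x = U(ζ)Ψ`, `Ψ_t = V(ζ)Ψ` with potentials `(u,v,w)`. -/
def SolvesLax (u v w : ℝ × ℝ → ℂ) (ζ : ℂ) (Ψ : ℝ × ℝ → Fin 4 → ℂ) : Prop :=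
  ∀ p : ℝ × ℝ,
    HasDerivAt (fun x => Ψ (x, p.2)) ((Ufield u v w ζ p).mulVec (Ψ p)) p.1 ∧
    HasDerivAt (fun t => Ψ (p.1, t)) ((Vfield u v w ζ p).mulVec (Ψ p)) p.2

/-- The rank-one projection `ψψ†/(ψ†ψ)`. -/
def projOf (ψ : Fin 4 → ℂ) : Matrix (Fin 4) (Fin 4) ℂ :=
  (star ψ ⬝ᵥ ψ)⁻¹ • vecMulVec ψ (star ψ)

/-- One-fold Darboux matrix `T(ζ) = I - ((ζ₁ - ζ₁*)/(ζ - ζ₁*)) ψψ†/(ψ†ψ)`. -/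
def Tone (ζ₁ ζ : ℂ) (ψ : Fin 4 → ℂ) : Matrix (Fin 4) (Fin 4) ℂ :=
  1 - ((ζ₁ - (starRingEnd ℂ) ζ₁) / (ζ - (starRingEnd ℂ) ζ₁)) • projOf ψ

/-- Transformed potential `f - 2i(ζ₁ - ζ₁*) Ψ₁⁰ (Ψ₁ʲ)* / (Ψ₁†Ψ₁)` of the one-fold DT. -/
def u1of (f : ℝ × ℝ → ℂ) (ζ₁ : ℂ) (Ψ₁ : ℝ × ℝ → Fin 4 → ℂ) (j : Fin 4) : ℝ × ℝ → ℂ :=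
  fun p => f p - 2 * Complex.I * (ζ₁ - (starRingEnd ℂ) ζ₁) * Ψ₁ p 0
      * (starRingEnd ℂ) (Ψ₁ p j) / (star (Ψ₁ p) ⬝ᵥ Ψ₁ p)

/-- The iterated eigenfunctions `Ψ_i^{(k)}` of the `N`-fold Darboux recursion
(0-based indexing: `PsiIter ζs Ψs k i = Ψ_{i+1}^{(k)}`). -/
def PsiIter (ζs : ℕ → ℂ) (Ψs : ℕ → ℝ × ℝ → Fin 4 → ℂ) : ℕ → ℕ → ℝ × ℝ → Fin 4 → ℂ
  | 0, i => Ψs i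
  | k + 1, i => fun p =>
      (Tone (ζs k) (ζs i) (PsiIter ζs Ψs k k p)).mulVec (PsiIter ζs Ψs k i p)

/-- The product `T_N(ζ) = T[N](ζ) ⋯ T[1](ζ)` of the `N`-fold Darboux recursion. -/
def TNmat (ζs : ℕ → ℂ) (Ψs : ℕ → ℝ × ℝ → Fin 4 → ℂ) :
    ℕ → ℂ → ℝ × ℝ → Matrix (Fin 4) (Fin 4) ℂ
  | 0, _, _ => 1
  | k + 1, ζ, p => Tone (ζs k) ζ (PsiIter ζs Ψs k k p) * TNmat ζs Ψs k ζ p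

/-- The explicit eigenfunction of the Lax pair for the zero seed at eigenvalue `ζk`. -/
def seedPsi (ζk : ℂ) (c₁ c₂ c₃ : ℝ) (p : ℝ × ℝ) : Fin 4 → ℂ :=
  ![Complex.exp (-Complex.I * ζk * (4 * p.2 * ζk ^ 2 + p.1)),
    c₁ * Complex.exp (Complex.I * ζk * (4 * p.2 * ζk ^ 2 + p.1)),
    c₂ * Complex.exp (Complex.I * ζk * (4 * p.2 * ζk ^ 2 + p.1)),
    c₃ * Complex.exp (Complex.I * ζk * (4 * p.2 * ζk ^ 2 + p.1))]

/-- The `N×N` matrix `M` with entries `M_{jk} = Ψ_j†Ψ_k/(ζ_k - ζ_j*)`. -/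
def MmatOf {N : ℕ} (ζs : Fin N → ℂ) (Ψs : Fin N → ℝ × ℝ → Fin 4 → ℂ) (p : ℝ × ℝ) :
    Matrix (Fin N) (Fin N) ℂ :=
  Matrix.of fun j k => (star (Ψs j p) ⬝ᵥ Ψs k p) / (ζs k - (starRingEnd ℂ) (ζs j))

/-- The `4×N` matrix `X = (Ψ₁, …, Ψ_N)` whose columns are the eigenfunctions. -/
def XmatOf {N : ℕ} (Ψs : Fin N → ℝ × ℝ → Fin 4 → ℂ) (p : ℝ × ℝ) :
    Matrix (Fin 4) (Fin N) ℂ :=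
  Matrix.of fun a j => Ψs j p a

/-- `M` bordered on the right by the column `c` and at the bottom by the row `(r, 0)`. -/
def bordered {N : ℕ} (M : Matrix (Fin N) (Fin N) ℂ) (c r : Fin N → ℂ) :
    Matrix (Fin (N + 1)) (Fin (N + 1)) ℂ :=
  Matrix.of fun i j =>
    Fin.lastCases
      (Fin.lastCases (0 : ℂ) (fun j' => r j') j)
      (fun i' => Fin.lastCases (c i') (fun j' => M i' j') j)
      i

/-- A function on `ℝ²` whose two partial derivatives exist and are locally bounded by a multiple
of the function is continuous. -/
theorem continuous_of_norm_partial_le {E : Type*} [NormedAddCommGroup E] [NormedSpace ℝ E]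
    {f fx ft : ℝ × ℝ → E} {c : ℝ × ℝ → ℝ} (hc : Continuous c)
    (hx : ∀ p : ℝ × ℝ, HasDerivAt (fun x => f (x, p.2)) (fx p) p.1)
    (ht : ∀ p : ℝ × ℝ, HasDerivAt (fun t => f (p.1, t)) (ft p) p.2)
    (hfx : ∀ p, ‖fx p‖ ≤ c p * ‖f p‖) (hft : ∀ p, ‖ft p‖ ≤ c p * ‖f p‖) :
    Continuous f := by
  rw [continuous_iff_continuousAt]
  intro p₀
  set R : ℝ := |p₀.1| + |p₀.2| + 1
  have hbox : IsCompact (Set.Icc (-R) R ×ˢ Set.Icc (-R) R) := isCompact_Icc.prod isCompact_Icc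
  obtain ⟨C₀, hC₀⟩ := hbox.exists_bound_of_continuousOn hc.continuousOn
  set C : ℝ := |C₀|
  have hC0 : 0 ≤ C := abs_nonneg _
  have hCb : ∀ x ∈ Set.Icc (-R) R, ∀ t ∈ Set.Icc (-R) R, c (x, t) ≤ C := fun x hx' t ht' =>
    (le_abs_self _).trans ((hC₀ (x, t) ⟨hx', ht'⟩).trans (le_abs_self _))
  have hR0 : 0 ≤ R := by positivity
  have hmem : -R ∈ Set.Icc (-R) R := ⟨le_rfl, by linarith⟩
  have hedge : ∀ t ∈ Set.Icc (-R) R, ‖f (-R, t)‖ ≤ ‖f (-R, -R)‖ * Real.exp (C * (2 * R)) := by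
    intro t ht'
    have h := norm_le_gronwallBound_of_norm_deriv_right_le (f := fun t => f (-R, t))
      (f' := fun t => ft (-R, t)) (δ := ‖f (-R, -R)‖) (K := C) (ε := 0) (a := -R) (b := R)
      (fun s _ => (ht (-R, s)).continuousAt.continuousWithinAt)
      (fun s _ => (ht (-R, s)).hasDerivWithinAt) le_rfl
      (fun s hs => by
        have h2 := hCb _ hmem s ⟨hs.1, hs.2.le⟩
        have h3 := hft (-R, s)
        nlinarith [norm_nonneg (f (-R, s))]) t ht'
    rw [gronwallBound_ε0] at h
    refine h.trans ?_
    gcongr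
    linarith [ht'.2]
  set M : ℝ := ‖f (-R, -R)‖ * Real.exp (C * (2 * R)) * Real.exp (C * (2 * R)) with hM
  have hbound : ∀ x ∈ Set.Icc (-R) R, ∀ t ∈ Set.Icc (-R) R, ‖f (x, t)‖ ≤ M := by
    intro x hx' t ht'
    have h := norm_le_gronwallBound_of_norm_deriv_right_le (f := fun x => f (x, t))
      (f' := fun x => fx (x, t)) (δ := ‖f (-R, -R)‖ * Real.exp (C * (2 * R)))
      (K := C) (ε := 0) (a := -R) (b := R)
      (fun s _ => (hx (s, t)).continuousAt.continuousWithinAt)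
      (fun s _ => (hx (s, t)).hasDerivWithinAt) (hedge t ht')
      (fun s hs => by
        have h2 := hCb s ⟨hs.1, hs.2.le⟩ t ht'
        have h3 := hfx (s, t)
        nlinarith [norm_nonneg (f (s, t))]) x hx'
    rw [gronwallBound_ε0] at h
    refine h.trans ?_
    rw [hM]
    gcongr
    linarith [hx'.2]
  have hcont : ContinuousOn f (Set.Icc (-R) R ×ˢ Set.Icc (-R) R) := by
    refine continuousOn_prod_of_continuousOn_lipschitzOnWith f (C * M).toNNReal
      (fun x _ s _ => (ht (x, s)).continuousAt.continuousWithinAt) fun t ht' => ?_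
    refine Convex.lipschitzOnWith_of_nnnorm_hasDerivWithin_le (convex_Icc _ _)
      (f' := fun x => fx (x, t)) (fun s _ => (hx (s, t)).hasDerivWithinAt) fun s hs => ?_
    rw [← NNReal.coe_le_coe, coe_nnnorm]
    refine le_trans ?_ (Real.le_coe_toNNReal _)
    exact (hfx (s, t)).trans (mul_le_mul (hCb s hs t ht') (hbound s hs t ht') (norm_nonneg _) hC0)
  refine hcont.continuousAt (prod_mem_nhds ?_ ?_)
  · exact Icc_mem_nhds (by linarith [neg_abs_le p₀.1, abs_nonneg p₀.2])
      (by linarith [le_abs_self p₀.1, abs_nonneg p₀.2])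
  · exact Icc_mem_nhds (by linarith [neg_abs_le p₀.2, abs_nonneg p₀.1])
      (by linarith [le_abs_self p₀.2, abs_nonneg p₀.1])

theorem hasFDerivAt_of_continuous_partial {E : Type*} [NormedAddCommGroup E] [NormedSpace ℝ E]
    {f fx ft : ℝ × ℝ → E}
    (hx : ∀ p : ℝ × ℝ, HasDerivAt (fun x => f (x, p.2)) (fx p) p.1)
    (ht : ∀ p : ℝ × ℝ, HasDerivAt (fun t => f (p.1, t)) (ft p) p.2)
    (hfx : Continuous fx) (hft : Continuous ft) (p : ℝ × ℝ) :
    HasFDerivAt f ((ContinuousLinearMap.toSpanSingleton ℝ (fx p)).coprod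
      (ContinuousLinearMap.toSpanSingleton ℝ (ft p))) p := by
  have hcx : Continuous fun q => ContinuousLinearMap.toSpanSingleton ℝ (fx q) :=
    (ContinuousLinearMap.toSpanSingletonCLE (𝕜 := ℝ)).continuous.comp hfx
  have hct : Continuous fun q => ContinuousLinearMap.toSpanSingleton ℝ (ft q) :=
    (ContinuousLinearMap.toSpanSingletonCLE (𝕜 := ℝ)).continuous.comp hft
  exact (hasStrictFDerivAt_uncurry_coprod (u := p) (f := fun x t => f (x, t))
    (f₁ := fun x t => ContinuousLinearMap.toSpanSingleton ℝ (fx (x, t)))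
    (f₂ := fun x t => ContinuousLinearMap.toSpanSingleton ℝ (ft (x, t)))
    (.of_forall fun q => (hx q).hasFDerivAt) (.of_forall fun q => (ht q).hasFDerivAt)
    hcx.continuousAt hct.continuousAt).hasFDerivAt

theorem contDiff_of_partial {E : Type*} [NormedAddCommGroup E] [NormedSpace ℝ E]
    {f fx ft : ℝ × ℝ → E} (hf : Continuous f)
    (hx : ∀ p : ℝ × ℝ, HasDerivAt (fun x => f (x, p.2)) (fx p) p.1)
    (ht : ∀ p : ℝ × ℝ, HasDerivAt (fun t => f (p.1, t)) (ft p) p.2)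
    (hfx : ∀ n : ℕ, ContDiff ℝ n f → ContDiff ℝ n fx)
    (hft : ∀ n : ℕ, ContDiff ℝ n f → ContDiff ℝ n ft) :
    ContDiff ℝ (⊤ : ℕ∞) f := by
  rw [contDiff_infty]
  have h0 : ContDiff ℝ 0 f := contDiff_zero.2 hf
  have hder := hasFDerivAt_of_continuous_partial hx ht
    (hfx 0 (mod_cast h0)).continuous (hft 0 (mod_cast h0)).continuous
  intro n
  induction n with
  | zero => exact_mod_cast h0
  | succ n ih =>
    have hdf : Differentiable ℝ f := fun p => (hder p).differentiableAt
    have hfd : fderiv ℝ f = fun p =>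
        (ContinuousLinearMap.fst ℝ ℝ ℝ).smulRight (fx p) +
        (ContinuousLinearMap.snd ℝ ℝ ℝ).smulRight (ft p) := by
      funext p
      rw [(hder p).fderiv]
      ext <;> simp
    push_cast
    rw [contDiff_succ_iff_fderiv]
    refine ⟨hdf, by simp, ?_⟩
    rw [hfd]
    exact (contDiff_const.smulRight (hfx n ih)).add (contDiff_const.smulRight (hft n ih))

/-- Symmetry of the mixed partial derivatives of a smooth function. -/
theorem partial_comm {E : Type*} [NormedAddCommGroup E] [NormedSpace ℝ E]
    {f fx ft : ℝ × ℝ → E} (hf : ContDiff ℝ (⊤ : ℕ∞) f)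
    (hx : ∀ p : ℝ × ℝ, HasDerivAt (fun x => f (x, p.2)) (fx p) p.1)
    (ht : ∀ p : ℝ × ℝ, HasDerivAt (fun t => f (p.1, t)) (ft p) p.2)
    {fxt ftx : E} {p : ℝ × ℝ}
    (hxt : HasDerivAt (fun t => fx (p.1, t)) fxt p.2)
    (htx : HasDerivAt (fun x => ft (x, p.2)) ftx p.1) : fxt = ftx := by
  have hd : ∀ q, HasFDerivAt f (fderiv ℝ f q) q := fun q =>
    (hf.differentiable (by simp) q).hasFDerivAt
  have hd2 : HasFDerivAt (fderiv ℝ f) (fderiv ℝ (fderiv ℝ f) p) p :=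
    ((hf.fderiv_right (m := 1) (by norm_cast)).differentiable (by simp) p).hasFDerivAt
  have hlx : ∀ q : ℝ × ℝ, HasDerivAt (fun x : ℝ => (x, q.2)) ((1 : ℝ), (0 : ℝ)) q.1 := fun q =>
    (hasDerivAt_id _).prodMk (hasDerivAt_const _ _)
  have hlt : ∀ q : ℝ × ℝ, HasDerivAt (fun t : ℝ => (q.1, t)) ((0 : ℝ), (1 : ℝ)) q.2 := fun q =>
    (hasDerivAt_const _ _).prodMk (hasDerivAt_id _)
  have ex : fx = fun q => fderiv ℝ f q (1, 0) := funext fun q =>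
    (hx q).unique ((hd q).comp_hasDerivAt q.1 (hlx q))
  have et : ft = fun q => fderiv ℝ f q (0, 1) := funext fun q =>
    (ht q).unique ((hd q).comp_hasDerivAt q.2 (hlt q))
  have h1 : HasDerivAt (fun t => fx (p.1, t)) (fderiv ℝ (fderiv ℝ f) p (0, 1) (1, 0)) p.2 := by
    rw [ex]
    exact (ContinuousLinearMap.apply ℝ E ((1 : ℝ), (0 : ℝ))).hasFDerivAt.comp_hasDerivAt p.2
      (hd2.comp_hasDerivAt p.2 (hlt p))
  have h2 : HasDerivAt (fun x => ft (x, p.2)) (fderiv ℝ (fderiv ℝ f) p (1, 0) (0, 1)) p.1 := by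
    rw [et]
    exact (ContinuousLinearMap.apply ℝ E ((0 : ℝ), (1 : ℝ))).hasFDerivAt.comp_hasDerivAt p.1
      (hd2.comp_hasDerivAt p.1 (hlx p))
  rw [hxt.unique h1, htx.unique h2]
  exact (hf.contDiffAt.isSymmSndFDerivAt (by simp; norm_cast)) _ _

section

variable {R : Type*} [Ring R]

/-- The coefficient of `ζ` in `V(ζ)` transforms by the Darboux recursion. -/
theorem darboux_coeff_one {K Q Qx S Q₁ Sx Q₁x : R} (hK : K * K = -1) (hQ : Q * K = -(K * Q))
    (hQx : Qx * K = -(K * Qx)) (hQ₁ : Q₁ = Q + K * S - S * K) (hSx : Sx = Q₁ * S - S * Q)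
    (hQ₁x : Q₁x = Qx + K * Sx - Sx * K) :
    2 * ((Q₁ ^ 2 + Q₁x) * K) = 2 * ((Q ^ 2 + Qx) * K) + 4 * (Q₁ * S) - 4 * (S * Q) := by
  have hK' : ∀ x, K * (K * x) = -x := fun x => by rw [← mul_assoc, hK]; simp
  have hQ' : ∀ x, Q * (K * x) = -(K * (Q * x)) := fun x => by
    rw [← mul_assoc, hQ]; simp [mul_assoc]
  subst hQ₁x hSx hQ₁
  simp only [pow_two, mul_add, add_mul, mul_sub, sub_mul, mul_assoc, hK, hK', hQ, hQ', hQx,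
    mul_neg, neg_mul, mul_one, neg_neg, two_mul]
  noncomm_ring

/-- The constant coefficient of `V(ζ)` transforms by the Darboux recursion. -/
theorem darboux_coeff_zero {K Q Qx Qxx S Q₁ Sx Q₁x Sxx Q₁xx : R} (hK : K * K = -1)
    (hQ : Q * K = -(K * Q)) (hQx : Qx * K = -(K * Qx))
    (hQ₁ : Q₁ = Q + K * S - S * K) (hSx : Sx = Q₁ * S - S * Q)
    (hQ₁x : Q₁x = Qx + K * Sx - Sx * K)
    (hSxx : Sxx = Q₁x * S + Q₁ * Sx - (Sx * Q + S * Qx))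
    (hQ₁xx : Q₁xx = Qxx + K * Sxx - Sxx * K) :
    -Q₁xx + 2 * Q₁ ^ 3 + Q₁x * Q₁ - Q₁ * Q₁x
      = (-Qxx + 2 * Q ^ 3 + Qx * Q - Q * Qx) + 2 * ((Q₁ ^ 2 + Q₁x) * K) * S
        - S * (2 * ((Q ^ 2 + Qx) * K)) := by
  have hK' : ∀ x, K * (K * x) = -x := fun x => by rw [← mul_assoc, hK]; simp
  have hQ' : ∀ x, Q * (K * x) = -(K * (Q * x)) := fun x => by
    rw [← mul_assoc, hQ]; simp [mul_assoc]
  have hQx' : ∀ x, Qx * (K * x) = -(K * (Qx * x)) := fun x => by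
    rw [← mul_assoc, hQx]; simp [mul_assoc]
  subst hQ₁xx hSxx hQ₁x hSx hQ₁
  simp only [pow_succ, pow_zero, one_mul, mul_add, add_mul, mul_sub, sub_mul, mul_assoc, hK, hK',
    hQ, hQ', hQx, hQx', mul_neg, neg_mul, mul_one, neg_neg, two_mul]
  abel

end

section

variable {A : Type*} [Ring A] [Algebra ℂ A]

/-- With `S = aP + b(1 - P)`, `P² = P`, substituting `S` on the right of a cubic pencil
evaluates it at `a` on the range of `P` and at `b` on the range of `1 - P`. -/
theorem pencil_eval_comm {P S V₀ V₁ V₂ V₃ M N : A} {a b : ℂ} (hP : P * P = P)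
    (hS : S = b • 1 + (a - b) • P)
    (hM : M = a ^ 3 • V₃ + a ^ 2 • V₂ + a • V₁ + V₀)
    (hN : N = b ^ 3 • V₃ + b ^ 2 • V₂ + b • V₁ + V₀) :
    (a - b) • ((1 - P) * M * P - P * N * (1 - P))
      = (V₀ + V₁ * S + V₂ * S ^ 2 + V₃ * S ^ 3) * S
        - S * (V₀ + V₁ * S + V₂ * S ^ 2 + V₃ * S ^ 3) := by
  subst hS hM hN
  simp only [pow_succ, pow_zero, one_mul, mul_add, add_mul, mul_sub, sub_mul, mul_assoc, hP,
    mul_one, smul_mul_assoc, mul_smul_comm, smul_add, smul_sub, smul_smul]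
  module

/-- `ζ - S` intertwines the cubic pencils with coefficients `V` and `W`. -/
theorem intertwine_cubic {S Sd V₀ V₁ V₂ V₃ W₀ W₁ W₂ W₃ : A} (ζ : ℂ)
    (h₃ : W₃ = V₃) (h₂ : W₂ = V₂ + W₃ * S - S * V₃) (h₁ : W₁ = V₁ + W₂ * S - S * V₂)
    (h₀ : W₀ = V₀ + W₁ * S - S * V₁) (hSd : Sd = W₀ * S - S * V₀) :
    -Sd + (ζ • 1 - S) * (ζ ^ 3 • V₃ + ζ ^ 2 • V₂ + ζ • V₁ + V₀)
      = (ζ ^ 3 • W₃ + ζ ^ 2 • W₂ + ζ • W₁ + W₀) * (ζ • 1 - S) := by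
  have e₂ : W₃ * S = W₂ - V₂ + S * V₃ := by rw [h₂]; abel
  have e₁ : W₂ * S = W₁ - V₁ + S * V₂ := by rw [h₁]; abel
  have e₀ : W₁ * S = W₀ - V₀ + S * V₁ := by rw [h₀]; abel
  have ed : W₀ * S = Sd + S * V₀ := by rw [hSd]; abel
  simp only [mul_add, add_mul, mul_sub, sub_mul, one_mul, mul_one, smul_mul_assoc, mul_smul_comm,
    e₂, e₁, e₀, ed, smul_add, smul_sub, smul_smul]
  rw [h₃]
  module

theorem intertwine_zero_curvature {R : Type*} [Ring R] {S Sx St Sxt Q Q₁ Qt Q₁t V₀ W₀ V₀x W₀x : R}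
    (hSx : Sx = Q₁ * S - S * Q) (hSt : St = W₀ * S - S * V₀)
    (h₁ : Sxt = Q₁t * S + Q₁ * St - (St * Q + S * Qt))
    (h₂ : Sxt = W₀x * S + W₀ * Sx - (Sx * V₀ + S * V₀x))
    (h : Qt = V₀x + V₀ * Q - Q * V₀) :
    (Q₁t - (W₀x + W₀ * Q₁ - Q₁ * W₀)) * S = 0 := by
  have h3 := h₁.symm.trans h₂
  rw [← sub_eq_zero] at h3
  rw [← h3, hSx, hSt, h]
  noncomm_ring

end

/-- `K = -iJ`, so that `U(ζ) = ζK + Q`. -/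
def Kmat : Matrix (Fin 4) (Fin 4) ℂ := (-Complex.I) • Jmat

/-- The coefficient of `ζ` in `V(ζ)`. -/
def laxV₁ (Q Qx : Matrix (Fin 4) (Fin 4) ℂ) : Matrix (Fin 4) (Fin 4) ℂ :=
  2 * ((Q ^ 2 + Qx) * Kmat)

/-- The constant coefficient of `V(ζ)`. -/
def laxV₀ (Q Qx Qxx : Matrix (Fin 4) (Fin 4) ℂ) : Matrix (Fin 4) (Fin 4) ℂ :=
  -Qxx + 2 * Q ^ 3 + Qx * Q - Q * Qx

/-- The matrix `S = ζ₁*(1 - P) + ζ₁P` with `P = ψψ†/(ψ†ψ)`, for which `(ζ - ζ₁*)T(ζ) = ζ - S`. -/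
def Smat (ζ₁ : ℂ) (ψ : Fin 4 → ℂ) : Matrix (Fin 4) (Fin 4) ℂ :=
  (starRingEnd ℂ) ζ₁ • 1 + (ζ₁ - (starRingEnd ℂ) ζ₁) • projOf ψ

theorem Kmat_mul_self : Kmat * Kmat = -1 := by
  ext i j
  fin_cases i <;> fin_cases j <;> simp [Kmat, Jmat]

theorem Qmat_mul_Kmat (a b c : ℂ) : Qmat a b c * Kmat = -(Kmat * Qmat a b c) := by
  ext i j
  fin_cases i <;> fin_cases j <;>
    simp [Kmat, Jmat, Qmat, Matrix.mul_apply, Matrix.diagonal] <;> ring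

theorem Kmat_conjTranspose : Kmatᴴ = -Kmat := by
  ext i j
  fin_cases i <;> fin_cases j <;> simp [Kmat, Jmat, Matrix.conjTranspose_apply]

theorem Qmat_conjTranspose (a b c : ℂ) : (Qmat a b c)ᴴ = -Qmat a b c := by
  ext i j
  fin_cases i <;> fin_cases j <;> simp [Qmat, Matrix.conjTranspose_apply]

theorem Umat_eq (ζ a b c : ℂ) : Umat ζ a b c =
    ζ ^ 3 • (0 : Matrix (Fin 4) (Fin 4) ℂ) + ζ ^ 2 • (0 : Matrix (Fin 4) (Fin 4) ℂ)
      + ζ • Kmat + Qmat a b c := by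
  simp only [Umat, Kmat]
  module

theorem Vmat_eq (ζ a b c ax bx cx axx bxx cxx : ℂ) :
    Vmat ζ a b c ax bx cx axx bxx cxx =
      ζ ^ 3 • (4 * Kmat) + ζ ^ 2 • (4 * Qmat a b c) + ζ • laxV₁ (Qmat a b c) (Qmat ax bx cx)
        + laxV₀ (Qmat a b c) (Qmat ax bx cx) (Qmat axx bxx cxx) := by
  have h4 : ∀ X : Matrix (Fin 4) (Fin 4) ℂ, 4 * X = (4 : ℂ) • X := fun X => by
    rw [Algebra.smul_def, map_ofNat]
  have h2 : ∀ X : Matrix (Fin 4) (Fin 4) ℂ, 2 * X = (2 : ℂ) • X := fun X => by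
    rw [Algebra.smul_def, map_ofNat]
  simp only [Vmat, laxV₁, laxV₀, Kmat, h4, h2, mul_smul_comm]
  module

theorem Umat_conjTranspose (ζ a b c : ℂ) :
    (Umat ζ a b c)ᴴ = -Umat ((starRingEnd ℂ) ζ) a b c := by
  simp only [Umat_eq, conjTranspose_add, conjTranspose_smul, Kmat_conjTranspose,
    Qmat_conjTranspose, conjTranspose_zero, starRingEnd_apply]
  module

theorem Vmat_conjTranspose (ζ a b c ax bx cx axx bxx cxx : ℂ) :
    (Vmat ζ a b c ax bx cx axx bxx cxx)ᴴ
      = -Vmat ((starRingEnd ℂ) ζ) a b c ax bx cx axx bxx cxx := by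
  have h₁ : (laxV₁ (Qmat a b c) (Qmat ax bx cx))ᴴ = -laxV₁ (Qmat a b c) (Qmat ax bx cx) := by
    have e : Qmat a b c * (Qmat a b c * Kmat) = Kmat * (Qmat a b c * Qmat a b c) := by
      rw [Qmat_mul_Kmat, mul_neg, ← mul_assoc, Qmat_mul_Kmat, neg_mul, neg_neg, mul_assoc]
    simp only [laxV₁, two_mul, conjTranspose_add, conjTranspose_mul, pow_two, Kmat_conjTranspose,
      Qmat_conjTranspose, neg_mul, mul_neg, neg_neg, add_mul, mul_add, mul_assoc, e,
      (neg_eq_iff_eq_neg.2 (Qmat_mul_Kmat ax bx cx)).symm]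
    abel
  have h₀ : (laxV₀ (Qmat a b c) (Qmat ax bx cx) (Qmat axx bxx cxx))ᴴ
      = -laxV₀ (Qmat a b c) (Qmat ax bx cx) (Qmat axx bxx cxx) := by
    simp only [laxV₀, two_mul, conjTranspose_add, conjTranspose_sub, conjTranspose_neg,
      conjTranspose_mul, conjTranspose_pow, Qmat_conjTranspose]
    noncomm_ring
  have h4 : ∀ X : Matrix (Fin 4) (Fin 4) ℂ, 4 * X = X + X + X + X := fun X => by noncomm_ring
  simp only [Vmat_eq, conjTranspose_add, conjTranspose_smul, h₁, h₀, h4, Kmat_conjTranspose,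
    Qmat_conjTranspose, starRingEnd_apply, star_pow]
  module

open ComplexOrder in
theorem star_dotProduct_self_ne_zero {ψ : Fin 4 → ℂ} (h : ψ ≠ 0) : star ψ ⬝ᵥ ψ ≠ 0 :=
  fun h0 => h (dotProduct_star_self_eq_zero.1 h0)

theorem projOf_mul_self {ψ : Fin 4 → ℂ} (h : ψ ≠ 0) : projOf ψ * projOf ψ = projOf ψ := by
  have hN := star_dotProduct_self_ne_zero h
  simp only [projOf, smul_mul_assoc, mul_smul_comm, vecMulVec_mul_vecMulVec, smul_smul,
    vecMulVec_smul]
  congr 1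
  field_simp

theorem Tone_eq_smul_sub_Smat (ζ₁ ζ : ℂ) (hζ : ζ ≠ (starRingEnd ℂ) ζ₁) (ψ : Fin 4 → ℂ) :
    Tone ζ₁ ζ ψ = (ζ - (starRingEnd ℂ) ζ₁)⁻¹ • (ζ • 1 - Smat ζ₁ ψ) := by
  have h : ζ - (starRingEnd ℂ) ζ₁ ≠ 0 := sub_ne_zero.2 hζ
  rw [Tone, Smat, ← sub_sub, ← sub_smul, smul_sub, smul_smul, smul_smul, inv_mul_cancel₀ h,
    one_smul, div_eq_inv_mul]

theorem isUnit_Smat {ζ₁ : ℂ} (hζ : ζ₁ ≠ 0) {ψ : Fin 4 → ℂ} (h : ψ ≠ 0) :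
    IsUnit (Smat ζ₁ ψ) := by
  have hP := projOf_mul_self h
  have hζ' : (starRingEnd ℂ) ζ₁ ≠ 0 := by simpa using hζ
  refine IsUnit.of_mul_eq_one
    (((starRingEnd ℂ) ζ₁)⁻¹ • 1 + (ζ₁⁻¹ - ((starRingEnd ℂ) ζ₁)⁻¹) • projOf ψ) ?_
  simp only [Smat, add_mul, mul_add, smul_mul_assoc, mul_smul_comm, one_mul, mul_one, hP]
  match_scalars <;> field_simp
  ring

theorem Qmat_u1of (u v w : ℝ × ℝ → ℂ) (ζ₁ : ℂ) (Ψ₁ : ℝ × ℝ → Fin 4 → ℂ) (p : ℝ × ℝ) :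
    Qmat (u1of u ζ₁ Ψ₁ 1 p) (u1of v ζ₁ Ψ₁ 2 p) (u1of w ζ₁ Ψ₁ 3 p)
      = Qmat (u p) (v p) (w p) + Kmat * Smat ζ₁ (Ψ₁ p) - Smat ζ₁ (Ψ₁ p) * Kmat := by
  have e : Kmat * Smat ζ₁ (Ψ₁ p) - Smat ζ₁ (Ψ₁ p) * Kmat
      = (ζ₁ - (starRingEnd ℂ) ζ₁) • (Kmat * projOf (Ψ₁ p) - projOf (Ψ₁ p) * Kmat) := by
    simp only [Smat, mul_add, add_mul, mul_smul_comm, smul_mul_assoc, mul_one, one_mul]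
    module
  have hN : (starRingEnd ℂ) (star (Ψ₁ p) ⬝ᵥ Ψ₁ p) = star (Ψ₁ p) ⬝ᵥ Ψ₁ p := by
    rw [starRingEnd_apply, ← star_dotProduct]
  rw [add_sub_assoc, e]
  ext i j
  fin_cases i <;> fin_cases j <;>
    simp [Qmat, u1of, Kmat, Jmat, projOf, vecMulVec_apply, hN, map_ofNat] <;> ring

section MatrixCalculus

open scoped Matrix.Norms.Operator

theorem hasDerivAt_matrix_entry {F : ℝ → Matrix (Fin 4) (Fin 4) ℂ} {F' : Matrix (Fin 4) (Fin 4) ℂ}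
    {x : ℝ} (h : HasDerivAt F F' x) (i j : Fin 4) : HasDerivAt (fun s => F s i j) (F' i j) x :=
  (LinearMap.toContinuousLinearMap (Matrix.entryLinearMap ℝ ℂ i j)).hasFDerivAt.comp_hasDerivAt x h

theorem contDiff_matrix_entry {F : ℝ × ℝ → Matrix (Fin 4) (Fin 4) ℂ} {n : WithTop ℕ∞}
    (h : ContDiff ℝ n F) (i j : Fin 4) : ContDiff ℝ n (fun s => F s i j) :=
  (LinearMap.toContinuousLinearMap (Matrix.entryLinearMap ℝ ℂ i j)).contDiff.comp h

theorem hasDerivAt_matrix {F : ℝ → Matrix (Fin 4) (Fin 4) ℂ} {F' : Matrix (Fin 4) (Fin 4) ℂ}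
    {x : ℝ} (h : ∀ i j, HasDerivAt (fun s => F s i j) (F' i j) x) : HasDerivAt F F' x := by
  have key : ∀ M : Matrix (Fin 4) (Fin 4) ℂ,
      M = ∑ i, ∑ j, M i j • Matrix.single i j (1 : ℂ) := fun M => by
    simpa using matrix_eq_sum_single M
  rw [key F', show F = fun s => ∑ i, ∑ j, F s i j • Matrix.single i j (1 : ℂ) from
    funext fun s => key (F s)]
  exact HasDerivAt.fun_sum fun i _ => HasDerivAt.fun_sum fun j _ => (h i j).smul_const _

theorem contDiff_matrix {F : ℝ × ℝ → Matrix (Fin 4) (Fin 4) ℂ} {n : WithTop ℕ∞}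
    (h : ∀ i j, ContDiff ℝ n (fun s => F s i j)) : ContDiff ℝ n F := by
  have key : ∀ M : Matrix (Fin 4) (Fin 4) ℂ,
      M = ∑ i, ∑ j, M i j • Matrix.single i j (1 : ℂ) := fun M => by
    simpa using matrix_eq_sum_single M
  rw [show F = fun s => ∑ i, ∑ j, F s i j • Matrix.single i j (1 : ℂ) from
    funext fun s => key (F s)]
  exact ContDiff.sum fun i _ => ContDiff.sum fun j _ => (h i j).smul contDiff_const

theorem hasDerivAt_conj {f : ℝ → ℂ} {f' : ℂ} {x : ℝ} (h : HasDerivAt f f' x) :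
    HasDerivAt (fun s => (starRingEnd ℂ) (f s)) ((starRingEnd ℂ) f') x :=
  h.star

theorem contDiff_conj {f : ℝ × ℝ → ℂ} {n : WithTop ℕ∞} (h : ContDiff ℝ n f) :
    ContDiff ℝ n (fun s => (starRingEnd ℂ) (f s)) :=
  Complex.conjCLE.contDiff.comp h

theorem hasDerivAt_Qmat {a b c : ℝ → ℂ} {a' b' c' : ℂ} {x : ℝ} (ha : HasDerivAt a a' x)
    (hb : HasDerivAt b b' x) (hc : HasDerivAt c c' x) :
    HasDerivAt (fun s => Qmat (a s) (b s) (c s)) (Qmat a' b' c') x := by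
  refine hasDerivAt_matrix fun i j => ?_
  fin_cases i <;> fin_cases j
  all_goals first
    | exact ha
    | exact hb
    | exact hc
    | exact hasDerivAt_const _ _
    | exact (hasDerivAt_conj ha).neg
    | exact (hasDerivAt_conj hb).neg
    | exact (hasDerivAt_conj hc).neg

theorem contDiff_Qmat {a b c : ℝ × ℝ → ℂ} {n : WithTop ℕ∞} (ha : ContDiff ℝ n a)
    (hb : ContDiff ℝ n b) (hc : ContDiff ℝ n c) :
    ContDiff ℝ n (fun s => Qmat (a s) (b s) (c s)) := by
  refine contDiff_matrix fun i j => ?_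
  fin_cases i <;> fin_cases j
  all_goals first
    | exact ha
    | exact hb
    | exact hc
    | exact contDiff_const
    | exact (contDiff_conj ha).neg
    | exact (contDiff_conj hb).neg
    | exact (contDiff_conj hc).neg

theorem contDiff_Umat {a b c : ℝ × ℝ → ℂ} {n : WithTop ℕ∞} (ζ : ℂ) (ha : ContDiff ℝ n a)
    (hb : ContDiff ℝ n b) (hc : ContDiff ℝ n c) :
    ContDiff ℝ n (fun s => Umat ζ (a s) (b s) (c s)) :=
  contDiff_const.add (contDiff_Qmat ha hb hc)

theorem contDiff_Vmat {a b c ax bx cx axx bxx cxx : ℝ × ℝ → ℂ} {n : WithTop ℕ∞} (ζ : ℂ)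
    (ha : ContDiff ℝ n a) (hb : ContDiff ℝ n b) (hc : ContDiff ℝ n c)
    (hax : ContDiff ℝ n ax) (hbx : ContDiff ℝ n bx) (hcx : ContDiff ℝ n cx)
    (haxx : ContDiff ℝ n axx) (hbxx : ContDiff ℝ n bxx) (hcxx : ContDiff ℝ n cxx) :
    ContDiff ℝ n (fun s => Vmat ζ (a s) (b s) (c s) (ax s) (bx s) (cx s)
      (axx s) (bxx s) (cxx s)) := by
  have h := contDiff_Qmat ha hb hc
  have hx := contDiff_Qmat hax hbx hcx
  have hxx := contDiff_Qmat haxx hbxx hcxx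
  unfold Vmat
  fun_prop

theorem contDiff_mulVec {F : ℝ × ℝ → Matrix (Fin 4) (Fin 4) ℂ} {ψ : ℝ × ℝ → Fin 4 → ℂ}
    {n : WithTop ℕ∞} (hF : ContDiff ℝ n F) (hψ : ContDiff ℝ n ψ) :
    ContDiff ℝ n (fun p => (F p).mulVec (ψ p)) := by
  rw [contDiff_pi]
  intro i
  have h := ContDiff.sum (s := Finset.univ) fun j _ =>
    (contDiff_matrix_entry hF i j).mul (contDiff_pi.1 hψ j)
  exact h

theorem hasDerivAt_mulVec {F : ℝ → Matrix (Fin 4) (Fin 4) ℂ} {ψ : ℝ → Fin 4 → ℂ}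
    {F' : Matrix (Fin 4) (Fin 4) ℂ} {ψ' : Fin 4 → ℂ} {x : ℝ} (hF : HasDerivAt F F' x)
    (hψ : HasDerivAt ψ ψ' x) :
    HasDerivAt (fun s => (F s).mulVec (ψ s)) (F'.mulVec (ψ x) + (F x).mulVec ψ') x := by
  rw [hasDerivAt_pi]
  intro i
  have h := HasDerivAt.fun_sum (u := Finset.univ) fun j _ =>
    (hasDerivAt_matrix_entry hF i j).mul (hasDerivAt_pi.1 hψ j)
  rw [Finset.sum_add_distrib] at h
  exact h

theorem hasDerivAt_projOf {ψ : ℝ → Fin 4 → ℂ} {M N : Matrix (Fin 4) (Fin 4) ℂ} {x : ℝ}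
    (hne : ψ x ≠ 0) (hψ : HasDerivAt ψ (M.mulVec (ψ x)) x) (hM : Mᴴ = -N) :
    HasDerivAt (fun s => projOf (ψ s))
      ((1 - projOf (ψ x)) * M * projOf (ψ x) - projOf (ψ x) * N * (1 - projOf (ψ x))) x := by
  have hN := star_dotProduct_self_ne_zero hne
  have hstar : star (M.mulVec (ψ x)) = -(star (ψ x) ᵥ* N) := by
    rw [star_mulVec, hM, vecMul_neg]
  have hconj : ∀ j, HasDerivAt (fun s => star (ψ s) j) ((-(star (ψ x) ᵥ* N)) j) x := fun j => by
    rw [← hstar]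
    exact (hasDerivAt_pi.1 hψ j).star
  have hdot : HasDerivAt (fun s => star (ψ s) ⬝ᵥ ψ s)
      (-(star (ψ x) ᵥ* N) ⬝ᵥ ψ x + star (ψ x) ⬝ᵥ M.mulVec (ψ x)) x := by
    have h := HasDerivAt.fun_sum (u := Finset.univ) fun j _ =>
      (hconj j).mul (hasDerivAt_pi.1 hψ j)
    rw [Finset.sum_add_distrib] at h
    exact h
  have hvec : HasDerivAt (fun s => vecMulVec (ψ s) (star (ψ s)))
      (vecMulVec (M.mulVec (ψ x)) (star (ψ x)) + vecMulVec (ψ x) (-(star (ψ x) ᵥ* N))) x :=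
    hasDerivAt_matrix fun i j => (hasDerivAt_pi.1 hψ i).mul (hconj j)
  refine ((hdot.inv hN).smul hvec).congr_deriv ?_
  have hB : ∀ X : Matrix (Fin 4) (Fin 4) ℂ,
      vecMulVec (ψ x) (star (ψ x)) * X * vecMulVec (ψ x) (star (ψ x))
        = (star (ψ x) ⬝ᵥ X.mulVec (ψ x)) • vecMulVec (ψ x) (star (ψ x)) := fun X => by
    rw [vecMulVec_mul, vecMulVec_mul_vecMulVec, vecMulVec_smul, dotProduct_mulVec]
  rw [← mul_vecMulVec, vecMulVec_neg, ← vecMulVec_mul, neg_dotProduct, ← dotProduct_mulVec]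
  simp only [projOf, Pi.inv_apply, sub_mul, mul_sub, one_mul, mul_one, smul_mul_assoc,
    mul_smul_comm, hB, smul_smul]
  match_scalars <;> field_simp
  ring

theorem hasDerivAt_Smat {ψ : ℝ → Fin 4 → ℂ} {M N V₀ V₁ V₂ V₃ : Matrix (Fin 4) (Fin 4) ℂ}
    {ζ₁ : ℂ} {x : ℝ} (hne : ψ x ≠ 0) (hψ : HasDerivAt ψ (M.mulVec (ψ x)) x) (hMN : Mᴴ = -N)
    (hM : M = ζ₁ ^ 3 • V₃ + ζ₁ ^ 2 • V₂ + ζ₁ • V₁ + V₀)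
    (hN : N = (starRingEnd ℂ) ζ₁ ^ 3 • V₃ + (starRingEnd ℂ) ζ₁ ^ 2 • V₂
      + (starRingEnd ℂ) ζ₁ • V₁ + V₀) :
    HasDerivAt (fun s => Smat ζ₁ (ψ s))
      ((V₀ + V₁ * Smat ζ₁ (ψ x) + V₂ * Smat ζ₁ (ψ x) ^ 2 + V₃ * Smat ζ₁ (ψ x) ^ 3)
          * Smat ζ₁ (ψ x)
        - Smat ζ₁ (ψ x) * (V₀ + V₁ * Smat ζ₁ (ψ x) + V₂ * Smat ζ₁ (ψ x) ^ 2
          + V₃ * Smat ζ₁ (ψ x) ^ 3)) x := by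
  rw [← pencil_eval_comm (S := Smat ζ₁ (ψ x)) (projOf_mul_self hne) rfl hM hN]
  exact ((hasDerivAt_projOf hne hψ hMN).const_smul (ζ₁ - (starRingEnd ℂ) ζ₁)).const_add _

theorem hasDerivAt_laxV₀ {Q Qx Qxx : ℝ → Matrix (Fin 4) (Fin 4) ℂ}
    {Qxxx : Matrix (Fin 4) (Fin 4) ℂ} {x : ℝ} (hQ : HasDerivAt Q (Qx x) x)
    (hQx : HasDerivAt Qx (Qxx x) x) (hQxx : HasDerivAt Qxx Qxxx x) :
    HasDerivAt (fun s => laxV₀ (Q s) (Qx s) (Qxx s))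
      (-Qxxx + 2 * (Qx x * Q x ^ 2 + Q x * Qx x * Q x + Q x ^ 2 * Qx x)
        + Qxx x * Q x - Q x * Qxx x) x := by
  have h3 : HasDerivAt (fun s => Q s ^ 3)
      (Qx x * Q x ^ 2 + Q x * Qx x * Q x + Q x ^ 2 * Qx x) x := by
    have h := (hQ.mul hQ).mul hQ
    simp only [pow_succ, pow_zero, one_mul]
    refine h.congr_deriv ?_
    simp only [Pi.mul_apply]
    noncomm_ring
  refine (((hQxx.neg.add (h3.const_mul 2)).add (hQx.mul hQ)).sub (hQ.mul hQx)).congr_deriv ?_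
  noncomm_ring

theorem hasDerivAt_Tone_mulVec {ζ₁ ζ : ℂ} (hζ : ζ ≠ (starRingEnd ℂ) ζ₁) {ψ φ : ℝ → Fin 4 → ℂ}
    {M M₁ Sd : Matrix (Fin 4) (Fin 4) ℂ} {x : ℝ}
    (hS : HasDerivAt (fun s => Smat ζ₁ (ψ s)) Sd x) (hφ : HasDerivAt φ (M.mulVec (φ x)) x)
    (h : -Sd + (ζ • 1 - Smat ζ₁ (ψ x)) * M = M₁ * (ζ • 1 - Smat ζ₁ (ψ x))) :
    HasDerivAt (fun s => (Tone ζ₁ ζ (ψ s)).mulVec (φ s))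
      (M₁.mulVec ((Tone ζ₁ ζ (ψ x)).mulVec (φ x))) x := by
  simp only [Tone_eq_smul_sub_Smat ζ₁ ζ hζ]
  refine (hasDerivAt_mulVec ((hS.const_sub (ζ • 1)).const_smul
    ((ζ - (starRingEnd ℂ) ζ₁)⁻¹)) hφ).congr_deriv ?_
  rw [mulVec_mulVec, mulVec_mulVec, ← add_mulVec, Pi.smul_apply, smul_mul_assoc, mul_smul_comm,
    ← smul_add, h]

end MatrixCalculus

theorem hasDerivAt_dX {f : ℝ × ℝ → ℂ} (hf : ContDiff ℝ (⊤ : ℕ∞) f) (p : ℝ × ℝ) :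
    HasDerivAt (fun x => f (x, p.2)) (dX f p) p.1 :=
  ((hf.comp (contDiff_id.prodMk contDiff_const)).differentiable (by simp) p.1).hasDerivAt

theorem hasDerivAt_dT {f : ℝ × ℝ → ℂ} (hf : ContDiff ℝ (⊤ : ℕ∞) f) (p : ℝ × ℝ) :
    HasDerivAt (fun t => f (p.1, t)) (dT f p) p.2 :=
  ((hf.comp (contDiff_const.prodMk contDiff_id)).differentiable (by simp) p.2).hasDerivAt

theorem contDiff_dX {f : ℝ × ℝ → ℂ} (hf : ContDiff ℝ (⊤ : ℕ∞) f) :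
    ContDiff ℝ (⊤ : ℕ∞) (dX f) := by
  have e : dX f = fun p => fderiv ℝ f p (1, 0) := funext fun p =>
    (hasDerivAt_dX hf p).unique
      ((hf.differentiable (by simp) p).hasFDerivAt.comp_hasDerivAt p.1
        ((hasDerivAt_id _).prodMk (hasDerivAt_const _ _)))
  rw [e]
  exact (hf.fderiv_right (m := (⊤ : ℕ∞)) (by norm_cast)).clm_apply contDiff_const

open scoped Matrix.Norms.Operator in
/-- Solutions of the Lax pair with smooth potentials are jointly smooth. -/
theorem SolvesLax.contDiff {u v w : ℝ × ℝ → ℂ} (hu : ContDiff ℝ (⊤ : ℕ∞) u)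
    (hv : ContDiff ℝ (⊤ : ℕ∞) v) (hw : ContDiff ℝ (⊤ : ℕ∞) w) {ζ : ℂ}
    {Ψ : ℝ × ℝ → Fin 4 → ℂ} (h : SolvesLax u v w ζ Ψ) : ContDiff ℝ (⊤ : ℕ∞) Ψ := by
  have hU : ContDiff ℝ (⊤ : ℕ∞) (Ufield u v w ζ) := contDiff_Umat ζ hu hv hw
  have hV : ContDiff ℝ (⊤ : ℕ∞) (Vfield u v w ζ) :=
    contDiff_Vmat ζ hu hv hw (contDiff_dX hu) (contDiff_dX hv) (contDiff_dX hw)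
      (contDiff_dX (contDiff_dX hu)) (contDiff_dX (contDiff_dX hv))
      (contDiff_dX (contDiff_dX hw))
  have hc : Continuous fun p => ‖Ufield u v w ζ p‖ + ‖Vfield u v w ζ p‖ :=
    hU.continuous.norm.add hV.continuous.norm
  have hcont : Continuous Ψ := by
    refine continuous_of_norm_partial_le hc (fun p => (h p).1) (fun p => (h p).2)
      (fun p => (linfty_opNorm_mulVec _ _).trans ?_)
      (fun p => (linfty_opNorm_mulVec _ _).trans ?_)
    · gcongr
      exact le_add_of_nonneg_right (norm_nonneg _)
    · gcongr
      exact le_add_of_nonneg_left (norm_nonneg _)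
  exact contDiff_of_partial hcont (fun p => (h p).1) (fun p => (h p).2)
    (fun n hn => contDiff_mulVec (hU.of_le (by exact_mod_cast le_top)) hn)
    (fun n hn => contDiff_mulVec (hV.of_le (by exact_mod_cast le_top)) hn)

theorem contDiff_star_dotProduct_inv {Ψ : ℝ × ℝ → Fin 4 → ℂ} (hΨ : ContDiff ℝ (⊤ : ℕ∞) Ψ)
    (hnz : ∀ p, Ψ p ≠ 0) : ContDiff ℝ (⊤ : ℕ∞) fun p => (star (Ψ p) ⬝ᵥ Ψ p)⁻¹ := by
  have h := ContDiff.sum (s := Finset.univ) fun j _ =>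
    (contDiff_conj (contDiff_pi.1 hΨ j)).mul (contDiff_pi.1 hΨ j)
  exact ContDiff.inv h fun p => star_dotProduct_self_ne_zero (hnz p)

theorem contDiff_u1of {f : ℝ × ℝ → ℂ} (hf : ContDiff ℝ (⊤ : ℕ∞) f) (ζ₁ : ℂ)
    {Ψ : ℝ × ℝ → Fin 4 → ℂ} (hΨ : ContDiff ℝ (⊤ : ℕ∞) Ψ) (hnz : ∀ p, Ψ p ≠ 0) (j : Fin 4) :
    ContDiff ℝ (⊤ : ℕ∞) (u1of f ζ₁ Ψ j) := by
  unfold u1of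
  simp only [div_eq_mul_inv]
  exact hf.sub (((contDiff_const.mul (contDiff_pi.1 hΨ 0)).mul
    (contDiff_conj (contDiff_pi.1 hΨ j))).mul (contDiff_star_dotProduct_inv hΨ hnz))

theorem contDiff_Smat_entry (ζ₁ : ℂ) {Ψ : ℝ × ℝ → Fin 4 → ℂ} (hΨ : ContDiff ℝ (⊤ : ℕ∞) Ψ)
    (hnz : ∀ p, Ψ p ≠ 0) (i j : Fin 4) :
    ContDiff ℝ (⊤ : ℕ∞) fun p => Smat ζ₁ (Ψ p) i j :=
  contDiff_const.add (contDiff_const.mul ((contDiff_star_dotProduct_inv hΨ hnz).mul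
    ((contDiff_pi.1 hΨ i).mul (contDiff_conj (contDiff_pi.1 hΨ j)))))

/-- Matrix form `Q_t = -Q_xxx + 3(Q_x Q² + Q² Q_x)` of the vcmKdV equation. -/
theorem vcmKdVeq_iff_Qmat (u v w : ℝ × ℝ → ℂ) : vcmKdVeq u v w ↔ ∀ p,
    Qmat (dT u p) (dT v p) (dT w p)
      = -Qmat (dX (dX (dX u)) p) (dX (dX (dX v)) p) (dX (dX (dX w)) p)
        + 3 * (Qmat (dX u p) (dX v p) (dX w p) * Qmat (u p) (v p) (w p) ^ 2
          + Qmat (u p) (v p) (w p) ^ 2 * Qmat (dX u p) (dX v p) (dX w p)) := by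
  have h3 : ∀ X : Matrix (Fin 4) (Fin 4) ℂ, 3 * X = (3 : ℂ) • X := fun X => by
    rw [Algebra.smul_def, map_ofNat]
  refine forall_congr' fun p => ⟨fun ⟨hu, hv, hw⟩ => ?_, fun h => ⟨?_, ?_, ?_⟩⟩
  · unfold vcmLHS at hu hv hw
    have hu' := congrArg (starRingEnd ℂ) hu
    have hv' := congrArg (starRingEnd ℂ) hv
    have hw' := congrArg (starRingEnd ℂ) hw
    simp only [map_add, map_mul, map_ofNat, Complex.conj_conj, map_zero] at hu' hv' hw'
    rw [h3]
    ext i j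
    fin_cases i <;> fin_cases j <;> simp [Qmat, pow_two]
    all_goals first
      | linear_combination hu
      | linear_combination hv
      | linear_combination hw
      | linear_combination -hu'
      | linear_combination -hv'
      | linear_combination -hw'
  all_goals
    unfold vcmLHS
    rw [h3] at h
  · have h' := congrFun (congrFun h 0) 1
    simp [Qmat, pow_two] at h'
    rw [h']; ring
  · have h' := congrFun (congrFun h 0) 2
    simp [Qmat, pow_two] at h'
    rw [h']; ring
  · have h' := congrFun (congrFun h 0) 3
    simp [Qmat, pow_two] at h'
    rw [h']; ring

/-- The potential matrix `Q` as a matrix-valued field on `ℝ²`. -/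
abbrev Qfield (u v w : ℝ × ℝ → ℂ) (p : ℝ × ℝ) : Matrix (Fin 4) (Fin 4) ℂ :=
  Qmat (u p) (v p) (w p)

/-- The coefficient of `ζ` in `V(ζ)` as a matrix-valued field on `ℝ²`. -/
abbrev laxV₁Field (u v w : ℝ × ℝ → ℂ) (p : ℝ × ℝ) : Matrix (Fin 4) (Fin 4) ℂ :=
  laxV₁ (Qfield u v w p) (Qfield (dX u) (dX v) (dX w) p)

/-- The constant coefficient of `V(ζ)` as a matrix-valued field on `ℝ²`. -/
abbrev laxV₀Field (u v w : ℝ × ℝ → ℂ) (p : ℝ × ℝ) : Matrix (Fin 4) (Fin 4) ℂ :=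
  laxV₀ (Qfield u v w p) (Qfield (dX u) (dX v) (dX w) p)
    (Qfield (dX (dX u)) (dX (dX v)) (dX (dX w)) p)

section Transformed

open scoped Matrix.Norms.Operator

theorem hasDerivAt_Qfield_fst {u v w : ℝ × ℝ → ℂ} (hu : ContDiff ℝ (⊤ : ℕ∞) u)
    (hv : ContDiff ℝ (⊤ : ℕ∞) v) (hw : ContDiff ℝ (⊤ : ℕ∞) w) (p : ℝ × ℝ) :
    HasDerivAt (fun x => Qfield u v w (x, p.2)) (Qfield (dX u) (dX v) (dX w) p) p.1 :=
  hasDerivAt_Qmat (hasDerivAt_dX hu p) (hasDerivAt_dX hv p) (hasDerivAt_dX hw p)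

theorem hasDerivAt_Qfield_snd {u v w : ℝ × ℝ → ℂ} (hu : ContDiff ℝ (⊤ : ℕ∞) u)
    (hv : ContDiff ℝ (⊤ : ℕ∞) v) (hw : ContDiff ℝ (⊤ : ℕ∞) w) (p : ℝ × ℝ) :
    HasDerivAt (fun t => Qfield u v w (p.1, t)) (Qfield (dT u) (dT v) (dT w) p) p.2 :=
  hasDerivAt_Qmat (hasDerivAt_dT hu p) (hasDerivAt_dT hv p) (hasDerivAt_dT hw p)

theorem vcmKdVeq_iff_laxV₀ {u v w : ℝ × ℝ → ℂ} (hu : ContDiff ℝ (⊤ : ℕ∞) u)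
    (hv : ContDiff ℝ (⊤ : ℕ∞) v) (hw : ContDiff ℝ (⊤ : ℕ∞) w) :
    ∃ V₀x : ℝ × ℝ → Matrix (Fin 4) (Fin 4) ℂ,
      (∀ p, HasDerivAt (fun x => laxV₀Field u v w (x, p.2)) (V₀x p) p.1) ∧
      (vcmKdVeq u v w ↔ ∀ p, Qfield (dT u) (dT v) (dT w) p
        = V₀x p + laxV₀Field u v w p * Qfield u v w p
          - Qfield u v w p * laxV₀Field u v w p) := by
  have hu₁ := contDiff_dX hu
  have hv₁ := contDiff_dX hv
  have hw₁ := contDiff_dX hw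
  refine ⟨_, fun p => hasDerivAt_laxV₀ (hasDerivAt_Qfield_fst hu hv hw p)
    (hasDerivAt_Qfield_fst hu₁ hv₁ hw₁ p)
    (hasDerivAt_Qfield_fst (contDiff_dX hu₁) (contDiff_dX hv₁) (contDiff_dX hw₁) p), ?_⟩
  rw [vcmKdVeq_iff_Qmat]
  refine forall_congr' fun p => Eq.congr_right ?_
  simp only [laxV₀]
  noncomm_ring

variable {u v w : ℝ × ℝ → ℂ} {ζ₁ : ℂ} {Ψ₁ : ℝ × ℝ → Fin 4 → ℂ}

theorem SolvesLax.hasDerivAt_Smat_fst (h : SolvesLax u v w ζ₁ Ψ₁) (hnz : ∀ p, Ψ₁ p ≠ 0)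
    (p : ℝ × ℝ) :
    HasDerivAt (fun x => Smat ζ₁ (Ψ₁ (x, p.2)))
      (Qfield (u1of u ζ₁ Ψ₁ 1) (u1of v ζ₁ Ψ₁ 2) (u1of w ζ₁ Ψ₁ 3) p * Smat ζ₁ (Ψ₁ p)
        - Smat ζ₁ (Ψ₁ p) * Qfield u v w p) p.1 := by
  refine (hasDerivAt_Smat (hnz p) (h p).1 (Umat_conjTranspose _ _ _ _) (Umat_eq _ _ _ _)
    (Umat_eq _ _ _ _)).congr_deriv ?_
  rw [Qfield, Qmat_u1of]
  noncomm_ring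

theorem SolvesLax.laxV_u1of (h : SolvesLax u v w ζ₁ Ψ₁) (hu : ContDiff ℝ (⊤ : ℕ∞) u)
    (hv : ContDiff ℝ (⊤ : ℕ∞) v) (hw : ContDiff ℝ (⊤ : ℕ∞) w) (hnz : ∀ p, Ψ₁ p ≠ 0)
    (p : ℝ × ℝ) :
    laxV₁Field (u1of u ζ₁ Ψ₁ 1) (u1of v ζ₁ Ψ₁ 2) (u1of w ζ₁ Ψ₁ 3) p
        = laxV₁Field u v w p
          + 4 * (Qfield (u1of u ζ₁ Ψ₁ 1) (u1of v ζ₁ Ψ₁ 2) (u1of w ζ₁ Ψ₁ 3) p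
            * Smat ζ₁ (Ψ₁ p))
          - 4 * (Smat ζ₁ (Ψ₁ p) * Qfield u v w p) ∧
      laxV₀Field (u1of u ζ₁ Ψ₁ 1) (u1of v ζ₁ Ψ₁ 2) (u1of w ζ₁ Ψ₁ 3) p
        = laxV₀Field u v w p
          + laxV₁Field (u1of u ζ₁ Ψ₁ 1) (u1of v ζ₁ Ψ₁ 2) (u1of w ζ₁ Ψ₁ 3) p
            * Smat ζ₁ (Ψ₁ p)
          - Smat ζ₁ (Ψ₁ p) * laxV₁Field u v w p := by
  have hΨ := h.contDiff hu hv hw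
  have hu' := contDiff_u1of hu ζ₁ hΨ hnz 1
  have hv' := contDiff_u1of hv ζ₁ hΨ hnz 2
  have hw' := contDiff_u1of hw ζ₁ hΨ hnz 3
  have hS := h.hasDerivAt_Smat_fst hnz
  have hQ₁ : ∀ q, Qfield (u1of u ζ₁ Ψ₁ 1) (u1of v ζ₁ Ψ₁ 2) (u1of w ζ₁ Ψ₁ 3) q
      = Qfield u v w q + Kmat * Smat ζ₁ (Ψ₁ q) - Smat ζ₁ (Ψ₁ q) * Kmat :=
    Qmat_u1of u v w ζ₁ Ψ₁
  have hQ₁x : ∀ q, Qfield (dX (u1of u ζ₁ Ψ₁ 1)) (dX (u1of v ζ₁ Ψ₁ 2)) (dX (u1of w ζ₁ Ψ₁ 3)) q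
      = _ := fun q => by
    refine (hasDerivAt_Qfield_fst hu' hv' hw' q).unique ?_
    simp only [hQ₁]
    exact ((hasDerivAt_Qfield_fst hu hv hw q).add ((hS q).const_mul Kmat)).sub
      ((hS q).mul_const Kmat)
  have hSx := ((hasDerivAt_Qfield_fst hu' hv' hw' p).mul (hS p)).sub
    ((hS p).mul (hasDerivAt_Qfield_fst hu hv hw p))
  have hQ₁xx := hasDerivAt_Qfield_fst (contDiff_dX hu') (contDiff_dX hv') (contDiff_dX hw') p
  simp only [hQ₁x] at hQ₁xx
  replace hQ₁xx := hQ₁xx.unique (((hasDerivAt_Qfield_fst (contDiff_dX hu) (contDiff_dX hv)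
    (contDiff_dX hw) p).add (hSx.const_mul Kmat)).sub (hSx.mul_const Kmat))
  exact ⟨darboux_coeff_one Kmat_mul_self (Qmat_mul_Kmat _ _ _) (Qmat_mul_Kmat _ _ _) (hQ₁ p) rfl
      (hQ₁x p),
    darboux_coeff_zero Kmat_mul_self (Qmat_mul_Kmat _ _ _) (Qmat_mul_Kmat _ _ _) (hQ₁ p) rfl
      (hQ₁x p) rfl hQ₁xx⟩

theorem SolvesLax.hasDerivAt_Smat_snd (h : SolvesLax u v w ζ₁ Ψ₁) (hu : ContDiff ℝ (⊤ : ℕ∞) u)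
    (hv : ContDiff ℝ (⊤ : ℕ∞) v) (hw : ContDiff ℝ (⊤ : ℕ∞) w) (hnz : ∀ p, Ψ₁ p ≠ 0)
    (p : ℝ × ℝ) :
    HasDerivAt (fun t => Smat ζ₁ (Ψ₁ (p.1, t)))
      (laxV₀Field (u1of u ζ₁ Ψ₁ 1) (u1of v ζ₁ Ψ₁ 2) (u1of w ζ₁ Ψ₁ 3) p * Smat ζ₁ (Ψ₁ p)
        - Smat ζ₁ (Ψ₁ p) * laxV₀Field u v w p) p.2 := by
  obtain ⟨h₁, h₀⟩ := h.laxV_u1of hu hv hw hnz p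
  refine (hasDerivAt_Smat (hnz p) (h p).2 (Vmat_conjTranspose _ _ _ _ _ _ _ _ _ _)
    (Vmat_eq _ _ _ _ _ _ _ _ _ _) (Vmat_eq _ _ _ _ _ _ _ _ _ _)).congr_deriv ?_
  rw [h₀, h₁, Qfield, Qmat_u1of]
  simp only [Prod.mk.eta, laxV₀Field, laxV₁Field, Qfield]
  generalize laxV₀ _ _ _ = V₀
  generalize laxV₁ _ _ = V₁
  noncomm_ring

theorem SolvesLax.darboux (h : SolvesLax u v w ζ₁ Ψ₁) (hu : ContDiff ℝ (⊤ : ℕ∞) u)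
    (hv : ContDiff ℝ (⊤ : ℕ∞) v) (hw : ContDiff ℝ (⊤ : ℕ∞) w) (hnz : ∀ p, Ψ₁ p ≠ 0) {ζ : ℂ}
    (hζ : ζ ≠ (starRingEnd ℂ) ζ₁) {Ψ : ℝ × ℝ → Fin 4 → ℂ} (hΨ : SolvesLax u v w ζ Ψ) :
    SolvesLax (u1of u ζ₁ Ψ₁ 1) (u1of v ζ₁ Ψ₁ 2) (u1of w ζ₁ Ψ₁ 3) ζ
      (fun p => (Tone ζ₁ ζ (Ψ₁ p)).mulVec (Ψ p)) := fun p => by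
  have hQ₁ := Qmat_u1of u v w ζ₁ Ψ₁ p
  obtain ⟨h₁, h₀⟩ := h.laxV_u1of hu hv hw hnz p
  constructor
  · refine hasDerivAt_Tone_mulVec hζ (h.hasDerivAt_Smat_fst hnz p) (hΨ p).1 ?_
    simp only [Ufield, Umat_eq]
    exact intertwine_cubic ζ rfl (by simp) (by simp) hQ₁ rfl
  · refine hasDerivAt_Tone_mulVec hζ (h.hasDerivAt_Smat_snd hu hv hw hnz p) (hΨ p).2 ?_
    simp only [Vfield, Vmat_eq]
    refine intertwine_cubic ζ rfl ?_ ?_ h₀ rfl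
    · rw [hQ₁]
      noncomm_ring
    · refine h₁.trans ?_
      simp only [Prod.mk.eta, laxV₁Field, Qfield]
      noncomm_ring

theorem SolvesLax.vcmKdVeq_u1of (h : SolvesLax u v w ζ₁ Ψ₁) (hu : ContDiff ℝ (⊤ : ℕ∞) u)
    (hv : ContDiff ℝ (⊤ : ℕ∞) v) (hw : ContDiff ℝ (⊤ : ℕ∞) w) (hnz : ∀ p, Ψ₁ p ≠ 0)
    (hζ₁ : ζ₁ ≠ 0) (hsol : vcmKdVeq u v w) :
    vcmKdVeq (u1of u ζ₁ Ψ₁ 1) (u1of v ζ₁ Ψ₁ 2) (u1of w ζ₁ Ψ₁ 3) := by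
  have hΨ := h.contDiff hu hv hw
  have hu' := contDiff_u1of hu ζ₁ hΨ hnz 1
  have hv' := contDiff_u1of hv ζ₁ hΨ hnz 2
  have hw' := contDiff_u1of hw ζ₁ hΨ hnz 3
  have hSx := h.hasDerivAt_Smat_fst hnz
  have hSt := h.hasDerivAt_Smat_snd hu hv hw hnz
  obtain ⟨V₀x, hV₀x, hV⟩ := vcmKdVeq_iff_laxV₀ hu hv hw
  obtain ⟨W₀x, hW₀x, hW⟩ := vcmKdVeq_iff_laxV₀ hu' hv' hw'
  refine hW.2 fun p => ?_
  have hSxt := ((hasDerivAt_Qfield_snd hu' hv' hw' p).mul (hSt p)).sub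
    ((hSt p).mul (hasDerivAt_Qfield_snd hu hv hw p))
  have hStx := ((hW₀x p).mul (hSx p)).sub ((hSx p).mul (hV₀x p))
  refine sub_eq_zero.1 ((isUnit_Smat hζ₁ (hnz p)).mul_left_eq_zero.1
    (intertwine_zero_curvature rfl rfl rfl ?_ (hV.1 hsol p)))
  ext i j
  exact partial_comm (contDiff_Smat_entry ζ₁ hΨ hnz i j)
    (fun q => hasDerivAt_matrix_entry (hSx q) i j) (fun q => hasDerivAt_matrix_entry (hSt q) i j)
    (hasDerivAt_matrix_entry hSxt i j) (hasDerivAt_matrix_entry hStx i j)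

end Transformed

/-- (i) `Ψ[1] = T[1](ζ)Ψ` solves the Lax pair with the transformed
potentials; (ii) the transformed potentials form a smooth solution of vcmKdV. -/
theorem one_fold_darboux_transformation (u v w : ℝ × ℝ → ℂ)
    (hu : ContDiff ℝ (⊤ : ℕ∞) u) (hv : ContDiff ℝ (⊤ : ℕ∞) v)
    (hw : ContDiff ℝ (⊤ : ℕ∞) w) (hsol : vcmKdVeq u v w)
    (ζ₁ : ℂ) (hζ : ζ₁ ≠ (starRingEnd ℂ) ζ₁)
    (Ψ₁ : ℝ × ℝ → Fin 4 → ℂ) (hnz : ∀ p : ℝ × ℝ, Ψ₁ p ≠ 0)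
    (hlax : SolvesLax u v w ζ₁ Ψ₁) :
    (∀ ζ : ℂ, ζ ≠ (starRingEnd ℂ) ζ₁ → ∀ Ψ : ℝ × ℝ → Fin 4 → ℂ,
        SolvesLax u v w ζ Ψ →
        SolvesLax (u1of u ζ₁ Ψ₁ 1) (u1of v ζ₁ Ψ₁ 2) (u1of w ζ₁ Ψ₁ 3) ζ
          (fun p => (Tone ζ₁ ζ (Ψ₁ p)).mulVec (Ψ p))) ∧
    ContDiff ℝ (⊤ : ℕ∞) (u1of u ζ₁ Ψ₁ 1) ∧
    ContDiff ℝ (⊤ : ℕ∞) (u1of v ζ₁ Ψ₁ 2) ∧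
    ContDiff ℝ (⊤ : ℕ∞) (u1of w ζ₁ Ψ₁ 3) ∧
    vcmKdVeq (u1of u ζ₁ Ψ₁ 1) (u1of v ζ₁ Ψ₁ 2) (u1of w ζ₁ Ψ₁ 3) := by
  have hΨ := hlax.contDiff hu hv hw
  have hζ₁ : ζ₁ ≠ 0 := by
    rintro rfl
    simp at hζ
  exact ⟨fun ζ h Ψ hΨζ => hlax.darboux hu hv hw hnz h hΨζ, contDiff_u1of hu ζ₁ hΨ hnz 1,
    contDiff_u1of hv ζ₁ hΨ hnz 2, contDiff_u1of hw ζ₁ hΨ hnz 3,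
    hlax.vcmKdVeq_u1of hu hv hw hnz hζ₁ hsol⟩

end
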